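/- Let T be a nondegenerate tetrahedron and define 𝔅₄(T) = { v ∈ P₄(T) : ∫_F v q ds = 0 for all q ∈ P₂(F) and all faces F of T }. Then dim 𝔅₄(T) = 11. -/

import Mathlib

open MeasureTheory MvPolynomial
open scoped RealInnerProductSpace

noncomputable section

/-- Euclidean 3-space. -/
abbrev E3 := EuclideanSpace ℝ (Fin 3)

/-- Evaluate a polynomial in 3 variables at a point of `E3`. -/
def evalP (x : E3) (p : MvPolynomial (Fin 3) ℝ) : ℝ :=
  MvPolynomial.eval (fun j => x j) p

/-- The (closed) facet of the tetrahedron opposite to vertex `i`. -/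
def face (a : Fin 4 → E3) (i : Fin 4) : Set E3 :=
  convexHull ℝ (a '' {j | j ≠ i})

/-- The (closed) tetrahedron with vertices `a`. -/
def tetra (a : Fin 4 → E3) : Set E3 :=
  convexHull ℝ (Set.range a)

/-- The reference triangle. -/
def Tri : Set (ℝ × ℝ) := {z | 0 ≤ z.1 ∧ 0 ≤ z.2 ∧ z.1 + z.2 ≤ 1}

lemma Tri_closed : IsClosed Tri := by
  unfold Tri
  have h1 : IsClosed {z : ℝ × ℝ | 0 ≤ z.1} := isClosed_le (by fun_prop) (by fun_prop)
  have h2 : IsClosed {z : ℝ × ℝ | 0 ≤ z.2} := isClosed_le (by fun_prop) (by fun_prop)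
  have h3 : IsClosed {z : ℝ × ℝ | z.1 + z.2 ≤ 1} := isClosed_le (by fun_prop) (by fun_prop)
  exact h1.inter (h2.inter h3)

lemma Tri_compact : IsCompact Tri := by
  refine IsCompact.of_isClosed_subset (isCompact_Icc (a := ((0:ℝ),(0:ℝ))) (b := ((1:ℝ),(1:ℝ)))) Tri_closed ?_
  rintro ⟨s, t⟩ ⟨h1, h2, h3⟩
  simp only at h1 h2 h3
  exact ⟨⟨h1, h2⟩, ⟨by simp only; linarith, by simp only; linarith⟩⟩

/-- Parametrization of the plane through three points. -/
def par (u v w : E3) (z : ℝ × ℝ) : E3 := z.1 • u + z.2 • v + (1 - z.1 - z.2) • w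

lemma par_continuous (u v w : E3) : Continuous (par u v w) := by
  unfold par; fun_prop

lemma par_integral (u v w : E3) (h : LinearIndependent ℝ ![u - w, v - w]) :
    ∃ c : ℝ, c ≠ 0 ∧ ∀ f : E3 → ℝ,
      ∫ x in par u v w '' Tri, f x ∂(μH[2]) = c * ∫ z in Tri, f (par u v w z) := by
  -- linear part
  let L : (ℝ × ℝ) →ₗ[ℝ] E3 :=
    (LinearMap.fst ℝ ℝ ℝ).smulRight (u - w) + (LinearMap.snd ℝ ℝ ℝ).smulRight (v - w)
  have hL : ∀ z, L z = z.1 • (u - w) + z.2 • (v - w) := fun z => by simp [L]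
  have hpar : ∀ z, par u v w z = L z + w := by
    intro z
    rw [hL, par]; module
  have hLinj : LinearMap.ker L = ⊥ := by
    rw [LinearMap.ker_eq_bot']
    rintro ⟨s, t⟩ hz
    rw [hL] at hz
    have := LinearIndependent.pair_iff.1 h s t hz
    ext <;> simp [this.1, this.2]
  obtain ⟨K, hK, hA⟩ := L.exists_antilipschitzWith hLinj
  have hLip := (LinearMap.toContinuousLinearMap L).lipschitz
  have hAp : AntilipschitzWith K (par u v w) := by
    intro x y
    rw [hpar, hpar, edist_add_right]
    exact hA x y
  have hLp : LipschitzWith ‖LinearMap.toContinuousLinearMap L‖₊ (par u v w) := by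
    intro x y
    rw [hpar, hpar, edist_add_right]
    exact hLip x y
  have hemb : MeasurableEmbedding (par u v w) :=
    (hAp.isClosedEmbedding hLp.uniformContinuous).measurableEmbedding
  let ν : Measure (ℝ × ℝ) := (μH[2] : Measure E3).comap (par u v w)
  have hν : ∀ s, ν s = μH[2] (par u v w '' s) := fun s => hemb.comap_apply _ _
  have i1 : ν.IsAddLeftInvariant := by
    constructor
    intro g
    ext s hs
    rw [Measure.map_apply (by fun_prop) hs, hν, hν]
    have : par u v w '' s = (IsometryEquiv.addLeft (L g)) '' (par u v w '' ((fun x => g + x) ⁻¹' s)) := by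
      ext y
      constructor
      · rintro ⟨z, hz, rfl⟩
        refine ⟨par u v w (z - g), ⟨z - g, by simpa using hz, rfl⟩, ?_⟩
        simp [hpar]
        abel
      · rintro ⟨_, ⟨z, hz, rfl⟩, rfl⟩
        refine ⟨g + z, hz, ?_⟩
        simp [hpar, add_assoc]
    rw [this, IsometryEquiv.hausdorffMeasure_image]
  have i2 : IsFiniteMeasureOnCompacts ν := by
    constructor
    intro s hs
    rw [hν]
    refine (hLp.hausdorffMeasure_image_le (by norm_num) s).trans_lt ?_
    rw [hausdorffMeasure_prod_real]
    exact ENNReal.mul_lt_top (by simp) hs.measure_lt_top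
  have i3 : ν.IsOpenPosMeasure := by
    constructor
    intro U hU hne h0
    rw [hν] at h0
    have := hAp.le_hausdorffMeasure_image (d := 2) (by norm_num) U
    rw [h0, hausdorffMeasure_prod_real, mul_zero] at this
    exact (hU.measure_pos volume hne).not_ge this
  have i4 : ν.IsAddHaarMeasure := {}
  have hsm : ν = (Measure.addHaarScalarFactor ν volume) • volume := Measure.isAddLeftInvariant_eq_smul ν volume
  have hpos := Measure.addHaarScalarFactor_pos_of_isAddHaarMeasure ν volume
  generalize Measure.addHaarScalarFactor ν volume = c at hsm hpos
  refine ⟨(c : ℝ), ?_, ?_⟩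
  · exact_mod_cast hpos.ne'
  · intro f
    have h1 : (μH[2] : Measure E3).restrict (par u v w '' Tri) = (ν.restrict Tri).map (par u v w) := by
      rw [hemb.restrict_comap, hemb.map_comap]
      rw [Measure.restrict_restrict hemb.measurableSet_range, Set.inter_eq_right.2 (Set.image_subset_range _ _)]
    rw [h1, hemb.integral_map, hsm, Measure.restrict_smul, integral_smul_nnreal_measure]
    rfl

lemma beta_aux (r : ℝ) (c : ℕ) : ∀ b : ℕ, ∫ t in (0:ℝ)..r, t ^ b * (r - t) ^ c =
    r ^ (b + c + 1) * (b.factorial * c.factorial / (b + c + 1).factorial) := by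
  induction c with
  | zero =>
    intro b
    simp [integral_pow, Nat.factorial_succ]
    field_simp
  | succ c ih =>
    intro b
    have h := intervalIntegral.integral_eq_sub_of_hasDerivAt (a := 0) (b := r)
      (f := fun t : ℝ => t ^ (b+1) * (r - t) ^ (c+1))
      (f' := fun t : ℝ => (b+1) * (t ^ b * (r - t) ^ (c+1)) - (c+1) * (t ^ (b+1) * (r-t)^c)) (by
        intro x _
        have h1 := hasDerivAt_pow (b+1) x
        have h2 := ((hasDerivAt_id x).const_sub r).pow (c+1)
        refine (h1.mul h2).congr_deriv ?_
        simp
        ring) (Continuous.intervalIntegrable (by fun_prop) _ _)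
    rw [intervalIntegral.integral_sub (Continuous.intervalIntegrable (by fun_prop) _ _) (Continuous.intervalIntegrable (by fun_prop) _ _),
      intervalIntegral.integral_const_mul, intervalIntegral.integral_const_mul, ih (b+1)] at h
    simp at h
    have e : b + 1 + c + 1 = b + (c + 1) + 1 := by ring
    rw [e] at h
    have hb : ((b:ℝ) + 1) ≠ 0 := by positivity
    apply mul_left_cancel₀ hb
    rw [sub_eq_zero.1 h]
    rw [Nat.factorial_succ b, Nat.factorial_succ c]
    push_cast
    ring

lemma tri_integral (a b c : ℕ) : ∫ z in Tri, z.1 ^ a * z.2 ^ b * (1 - z.1 - z.2) ^ c =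
    (a.factorial * b.factorial * c.factorial : ℝ) / (a + b + c + 2).factorial := by
  have hm : MeasurableSet Tri := Tri_closed.measurableSet
  rw [← integral_indicator hm]
  have hint : Integrable (Tri.indicator fun z : ℝ × ℝ => z.1 ^ a * z.2 ^ b * (1 - z.1 - z.2) ^ c) := by
    rw [integrable_indicator_iff hm]
    exact ContinuousOn.integrableOn_compact Tri_compact (by fun_prop)
  rw [Measure.volume_eq_prod] at hint ⊢
  rw [integral_prod _ hint]
  have h1 : ∀ s : ℝ, ∫ t : ℝ, (Tri.indicator fun z : ℝ × ℝ => z.1 ^ a * z.2 ^ b * (1 - z.1 - z.2) ^ c) (s, t)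
      = (Set.Icc (0:ℝ) 1).indicator (fun s => s ^ a * ((1 - s) ^ (b + c + 1) * (b.factorial * c.factorial / (b + c + 1).factorial))) s := by
    intro s
    by_cases hs : s ∈ Set.Icc (0:ℝ) 1
    · rw [Set.indicator_of_mem hs, ← beta_aux, intervalIntegral.integral_of_le (by linarith [hs.2]),
        ← integral_Icc_eq_integral_Ioc, ← integral_const_mul, ← integral_indicator measurableSet_Icc]
      congr 1
      ext t
      by_cases ht : t ∈ Set.Icc 0 (1 - s)
      · rw [Set.indicator_of_mem ht, Set.indicator_of_mem]
        · ring
        · exact ⟨hs.1, ht.1, by simp only; linarith [ht.2]⟩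
      · rw [Set.indicator_of_notMem ht, Set.indicator_of_notMem]
        rintro ⟨h1, h2, h3⟩
        simp only at h1 h2 h3
        exact ht ⟨h2, by linarith⟩
    · rw [Set.indicator_of_notMem hs]
      rw [← integral_zero ℝ ℝ]
      congr 1
      ext t
      rw [Set.indicator_of_notMem]
      rintro ⟨h1, h2, h3⟩
      simp only at h1 h2 h3
      exact hs ⟨h1, by linarith⟩
  simp_rw [h1]
  rw [integral_indicator measurableSet_Icc, integral_Icc_eq_integral_Ioc, ← intervalIntegral.integral_of_le (by norm_num)]
  simp_rw [← mul_assoc]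
  rw [intervalIntegral.integral_mul_const, beta_aux]
  have e : a + (b + c + 1) + 1 = a + b + c + 2 := by ring
  rw [e]
  have := Nat.factorial_ne_zero (b + c + 1)
  field_simp
  ring

lemma exists_lam (a : Fin 4 → E3) (hind : AffineIndependent ℝ a) :
    ∃ lam : Fin 4 → MvPolynomial (Fin 3) ℝ, (∀ i, (lam i).totalDegree ≤ 1) ∧
      1 ∈ Submodule.span ℝ (Set.range lam) ∧
      (∀ j, X j ∈ Submodule.span ℝ (Set.range lam)) ∧
      (∀ i u v w z, evalP (par u v w z) (lam i) =
        z.1 * evalP u (lam i) + z.2 * evalP v (lam i) + (1 - z.1 - z.2) * evalP w (lam i)) ∧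
      ∀ i j, evalP (a j) (lam i) = if i = j then 1 else 0 := by
  have htop : affineSpan ℝ (Set.range a) = ⊤ := by
    rw [hind.affineSpan_eq_top_iff_card_eq_finrank_add_one]
    simp
  let b : AffineBasis (Fin 4) ℝ E3 := ⟨a, hind, htop⟩
  let lam : Fin 4 → MvPolynomial (Fin 3) ℝ := fun i =>
    C (b.coord i 0) + ∑ k, C ((b.coord i).linear (EuclideanSpace.single k 1)) * X k
  have hev : ∀ i x, evalP x (lam i) = b.coord i x := by
    intro i x
    have hx : x = ∑ k, x k • EuclideanSpace.single k (1:ℝ) := by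
      ext j
      simp [Fin.sum_univ_three]
      fin_cases j <;> simp
    have h2 : b.coord i x = (b.coord i).linear x + b.coord i 0 := by
      conv_lhs => rw [AffineMap.decomp (b.coord i)]
      simp
    have h3 : (b.coord i).linear x = ∑ k, x k * (b.coord i).linear (EuclideanSpace.single k 1) := by
      conv_lhs => rw [hx]
      rw [map_sum]
      simp only [map_smul, smul_eq_mul]
    rw [h2, h3]
    simp only [lam, evalP, map_add, map_sum, map_mul, eval_C, eval_X]
    rw [add_comm]
    congr 1
    exact Finset.sum_congr rfl fun k _ => mul_comm _ _
  have hpoly : ∀ p q : MvPolynomial (Fin 3) ℝ, (∀ x : E3, evalP x p = evalP x q) → p = q := by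
    intro p q h
    apply MvPolynomial.funext
    intro x
    simpa [evalP] using h (WithLp.toLp 2 x)
  refine ⟨lam, ?_, ?_, ?_, ?_, ?_⟩
  · intro i
    refine (totalDegree_add _ _).trans (max_le (by simp) ?_)
    refine (totalDegree_finsetSum _ _).trans (Finset.sup_le fun k _ => ?_)
    refine (totalDegree_mul _ _).trans ?_
    rw [totalDegree_C, totalDegree_X]
  · have : (1 : MvPolynomial (Fin 3) ℝ) = ∑ i, lam i := by
      apply hpoly
      intro x
      have := b.sum_coord_apply_eq_one x
      simp only [← hev] at this
      simp only [evalP, map_sum, map_one] at this ⊢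
      exact this.symm
    rw [this]
    exact Submodule.sum_mem _ fun i _ => Submodule.subset_span ⟨i, rfl⟩
  · intro j
    have : (X j : MvPolynomial (Fin 3) ℝ) = ∑ i, (a i j) • lam i := by
      apply hpoly
      intro x
      have := congrArg (fun y : E3 => y j) (b.linear_combination_coord_eq_self x)
      simp only [← hev] at this
      simp only [evalP, map_sum, eval_X, smul_eval] at this ⊢
      rw [← this]
      simp [mul_comm]
      rfl
    rw [this]
    exact Submodule.sum_mem _ fun i _ => Submodule.smul_mem _ _ (Submodule.subset_span ⟨i, rfl⟩)
  · intro i u v w z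
    simp only [hev]
    have h2 : ∀ x, b.coord i x = (b.coord i).linear x + b.coord i 0 := by
      intro x
      conv_lhs => rw [AffineMap.decomp (b.coord i)]
      simp
    rw [h2, h2 u, h2 v, h2 w, par]
    simp only [map_add, map_smul, smul_eq_mul]
    ring
  · intro i j
    rw [hev]
    exact b.coord_apply i j

/-- parametrization of face `i`. -/
def fpar (a : Fin 4 → E3) (i : Fin 4) : ℝ × ℝ → E3 :=
  par (a (i.succAbove 0)) (a (i.succAbove 1)) (a (i.succAbove 2))

lemma face_eq (a : Fin 4 → E3) (i : Fin 4) : face a i = fpar a i '' Tri := by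
  apply Set.Subset.antisymm
  · apply convexHull_min
    · rintro _ ⟨j, hj, rfl⟩
      obtain ⟨k, rfl⟩ := Fin.exists_succAbove_eq hj
      fin_cases k
      · exact ⟨(1, 0), by simp [Tri], by simp [fpar, par]⟩
      · exact ⟨(0, 1), by simp [Tri], by simp [fpar, par]⟩
      · exact ⟨(0, 0), by simp [Tri], by simp [fpar, par]⟩
    · rintro _ ⟨⟨s, t⟩, ⟨h1, h2, h3⟩, rfl⟩ _ ⟨⟨s', t'⟩, ⟨h1', h2', h3'⟩, rfl⟩ α β hα hβ hαβ
      simp only at h1 h2 h3 h1' h2' h3'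
      refine ⟨(α * s + β * s', α * t + β * t'), ⟨by simp only; positivity, by simp only; positivity, ?_⟩, ?_⟩
      · simp only
        nlinarith
      · obtain rfl : β = 1 - α := by linarith
        simp only [fpar, par]
        module
  · rintro _ ⟨⟨s, t⟩, ⟨h1, h2, h3⟩, rfl⟩
    simp only at h1 h2 h3
    have hc : Convex ℝ (face a i) := convex_convexHull ℝ _
    have hm : ∀ k, a (i.succAbove k) ∈ face a i := fun k =>
      subset_convexHull ℝ _ ⟨_, Fin.succAbove_ne i k, rfl⟩
    have := hc.sum_mem (t := Finset.univ) (w := ![s, t, 1 - s - t]) (z := fun k => a (i.succAbove k))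
      (by intro k _; fin_cases k <;> simp <;> linarith) (by simp [Fin.sum_univ_three]) (fun k _ => hm k)
    simpa [Fin.sum_univ_three, fpar, par] using this

lemma evalP_continuous (p : MvPolynomial (Fin 3) ℝ) : Continuous fun x : E3 => evalP x p := by
  unfold evalP
  exact (MvPolynomial.continuous_eval p).comp (by fun_prop)

/-- The integral of a polynomial over the reference triangle, pulled back to face `i`. -/
def J (a : Fin 4 → E3) (i : Fin 4) : MvPolynomial (Fin 3) ℝ →ₗ[ℝ] ℝ where
  toFun p := ∫ z in Tri, evalP (fpar a i z) p
  map_add' p q := by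
    have hi : ∀ p, IntegrableOn (fun z => evalP (fpar a i z) p) Tri := fun p =>
      ContinuousOn.integrableOn_compact Tri_compact
        ((evalP_continuous p).comp (par_continuous _ _ _)).continuousOn
    rw [← integral_add (hi p) (hi q)]
    simp [evalP]
  map_smul' c p := by
    rw [RingHom.id_apply, smul_eq_mul, ← integral_const_mul]
    simp [evalP]

lemma J_lam (a : Fin 4 → E3) (lam : Fin 4 → MvPolynomial (Fin 3) ℝ)
    (h1 : ∀ i u v w z, evalP (par u v w z) (lam i) =
        z.1 * evalP u (lam i) + z.2 * evalP v (lam i) + (1 - z.1 - z.2) * evalP w (lam i))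
    (h2 : ∀ i j, evalP (a j) (lam i) = if i = j then 1 else 0) (i : Fin 4) (α : Fin 4 → ℕ) :
    J a i (∏ j, lam j ^ α j) =
      if α i = 0 then (∏ j, ((α j).factorial : ℝ)) / ((∑ j, α j) + 2).factorial else 0 := by
  have hz : ∀ z, evalP (fpar a i z) (∏ j, lam j ^ α j) =
      0 ^ α i * (z.1 ^ α (i.succAbove 0) * z.2 ^ α (i.succAbove 1) * (1 - z.1 - z.2) ^ α (i.succAbove 2)) := by
    intro z
    have hp : evalP (fpar a i z) (∏ j, lam j ^ α j) = ∏ j, evalP (fpar a i z) (lam j) ^ α j := by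
      simp [evalP]
    rw [hp, Fin.prod_univ_succAbove _ i, Fin.prod_univ_three]
    simp only [fpar, h1, h2]
    simp [Fin.ne_succAbove]
  change ∫ z in Tri, evalP (fpar a i z) _ = _
  simp_rw [hz]
  rw [integral_const_mul, tri_integral, Fin.prod_univ_succAbove _ i, Fin.sum_univ_succAbove _ i,
    Fin.prod_univ_three, Fin.sum_univ_three]
  by_cases h : α i = 0
  · simp [h]
  · simp [h]

lemma face_integral (a : Fin 4 → E3) (lam : Fin 4 → MvPolynomial (Fin 3) ℝ)
    (h1 : ∀ i u v w z, evalP (par u v w z) (lam i) =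
        z.1 * evalP u (lam i) + z.2 * evalP v (lam i) + (1 - z.1 - z.2) * evalP w (lam i))
    (h2 : ∀ i j, evalP (a j) (lam i) = if i = j then 1 else 0) (i : Fin 4) :
    ∃ c : ℝ, c ≠ 0 ∧ ∀ p q, ∫ x in face a i, evalP x p * evalP x q ∂(μH[2]) = c * J a i (p * q) := by
  have hli : LinearIndependent ℝ ![a (i.succAbove 0) - a (i.succAbove 2), a (i.succAbove 1) - a (i.succAbove 2)] := by
    rw [LinearIndependent.pair_iff]
    intro s t h
    have hp : par (a (i.succAbove 0)) (a (i.succAbove 1)) (a (i.succAbove 2)) (s, t) = a (i.succAbove 2) := by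
      have : par (a (i.succAbove 0)) (a (i.succAbove 1)) (a (i.succAbove 2)) (s, t) =
        (s • (a (i.succAbove 0) - a (i.succAbove 2)) + t • (a (i.succAbove 1) - a (i.succAbove 2))) + a (i.succAbove 2) := by
        simp only [par]; module
      rw [this, h, zero_add]
    have e0 := congrArg (fun x => evalP x (lam (i.succAbove 0))) hp
    have e1 := congrArg (fun x => evalP x (lam (i.succAbove 1))) hp
    simp only [h1, h2] at e0 e1
    simp at e0 e1
    exact ⟨e0, e1⟩
  obtain ⟨c, hc, hf⟩ := par_integral _ _ _ hli
  refine ⟨c, hc, fun p q => ?_⟩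
  rw [face_eq]
  refine (hf _).trans ?_
  congr 1
  simp [J, evalP, fpar]

/-- First index of the pair `s`. -/
def k1 : Fin 6 → Fin 3 := ![0, 1, 2, 0, 0, 1]

/-- Second index of the pair `s`. -/
def k2 : Fin 6 → Fin 3 := ![0, 1, 2, 1, 2, 2]

/-- Exponents of the `s`-th quadratic monomial on face `i`. -/
def ex (i : Fin 4) (s : Fin 6) (j : Fin 4) : ℕ :=
  (if j = i.succAbove (k1 s) then 1 else 0) + (if j = i.succAbove (k2 s) then 1 else 0)

/-- Normalized moments. -/
def KK (α : Fin 4 → ℕ) (i : Fin 4) (s : Fin 6) : ℕ :=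
  if α i = 0 then ∏ j, (α j + ex i s j).factorial else 0

set_option linter.unusedSimpArgs false in
set_option maxHeartbeats 4000000 in
lemma comb (c : Fin 4 → Fin 6 → ℝ)
    (h : ∀ α : Fin 4 → ℕ, ∑ j, α j = 4 → ∑ i, ∑ s, c i s * (KK α i s : ℝ) = 0) :
    ∀ i s, c i s = 0 := by
  have key : ∀ (α : Fin 4 → ℕ) (T : Fin 4 → Fin 6 → ℕ), ∑ j, α j = 4 → KK α = T →
      (c 0 0 * T 0 0 + c 0 1 * T 0 1 + c 0 2 * T 0 2 + c 0 3 * T 0 3 + c 0 4 * T 0 4 + c 0 5 * T 0 5) +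
      (c 1 0 * T 1 0 + c 1 1 * T 1 1 + c 1 2 * T 1 2 + c 1 3 * T 1 3 + c 1 4 * T 1 4 + c 1 5 * T 1 5) +
      (c 2 0 * T 2 0 + c 2 1 * T 2 1 + c 2 2 * T 2 2 + c 2 3 * T 2 3 + c 2 4 * T 2 4 + c 2 5 * T 2 5) +
      (c 3 0 * T 3 0 + c 3 1 * T 3 1 + c 3 2 * T 3 2 + c 3 3 * T 3 3 + c 3 4 * T 3 4 + c 3 5 * T 3 5) = (0 : ℝ) := by
    intro α T h1 h2
    have := h α h1
    rw [h2] at this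
    simpa only [Fin.sum_univ_four, Fin.sum_univ_six] using this
  have e1021 := key ![1, 0, 2, 1] ![![0, 0, 0, 0, 0, 0], ![12, 24, 12, 12, 8, 12], ![0, 0, 0, 0, 0, 0], ![0, 0, 0, 0, 0, 0]] (by decide) (by decide)
  simp only [Matrix.cons_val, Nat.cast_ofNat, Nat.cast_zero, mul_zero, add_zero, zero_add] at e1021
  have e1210 := key ![1, 2, 1, 0] ![![0, 0, 0, 0, 0, 0], ![0, 0, 0, 0, 0, 0], ![0, 0, 0, 0, 0, 0], ![12, 24, 12, 12, 8, 12]] (by decide) (by decide)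
  simp only [Matrix.cons_val, Nat.cast_ofNat, Nat.cast_zero, mul_zero, add_zero, zero_add] at e1210
  have e1201 := key ![1, 2, 0, 1] ![![0, 0, 0, 0, 0, 0], ![0, 0, 0, 0, 0, 0], ![12, 24, 12, 12, 8, 12], ![0, 0, 0, 0, 0, 0]] (by decide) (by decide)
  simp only [Matrix.cons_val, Nat.cast_ofNat, Nat.cast_zero, mul_zero, add_zero, zero_add] at e1201
  have e2101 := key ![2, 1, 0, 1] ![![0, 0, 0, 0, 0, 0], ![0, 0, 0, 0, 0, 0], ![24, 12, 12, 12, 12, 8], ![0, 0, 0, 0, 0, 0]] (by decide) (by decide)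
  simp only [Matrix.cons_val, Nat.cast_ofNat, Nat.cast_zero, mul_zero, add_zero, zero_add] at e2101
  have e0121 := key ![0, 1, 2, 1] ![![12, 24, 12, 12, 8, 12], ![0, 0, 0, 0, 0, 0], ![0, 0, 0, 0, 0, 0], ![0, 0, 0, 0, 0, 0]] (by decide) (by decide)
  simp only [Matrix.cons_val, Nat.cast_ofNat, Nat.cast_zero, mul_zero, add_zero, zero_add] at e0121
  have e1102 := key ![1, 1, 0, 2] ![![0, 0, 0, 0, 0, 0], ![0, 0, 0, 0, 0, 0], ![12, 12, 24, 8, 12, 12], ![0, 0, 0, 0, 0, 0]] (by decide) (by decide)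
  simp only [Matrix.cons_val, Nat.cast_ofNat, Nat.cast_zero, mul_zero, add_zero, zero_add] at e1102
  have e0112 := key ![0, 1, 1, 2] ![![12, 12, 24, 8, 12, 12], ![0, 0, 0, 0, 0, 0], ![0, 0, 0, 0, 0, 0], ![0, 0, 0, 0, 0, 0]] (by decide) (by decide)
  simp only [Matrix.cons_val, Nat.cast_ofNat, Nat.cast_zero, mul_zero, add_zero, zero_add] at e0112
  have e2011 := key ![2, 0, 1, 1] ![![0, 0, 0, 0, 0, 0], ![24, 12, 12, 12, 12, 8], ![0, 0, 0, 0, 0, 0], ![0, 0, 0, 0, 0, 0]] (by decide) (by decide)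
  simp only [Matrix.cons_val, Nat.cast_ofNat, Nat.cast_zero, mul_zero, add_zero, zero_add] at e2011
  have e0211 := key ![0, 2, 1, 1] ![![24, 12, 12, 12, 12, 8], ![0, 0, 0, 0, 0, 0], ![0, 0, 0, 0, 0, 0], ![0, 0, 0, 0, 0, 0]] (by decide) (by decide)
  simp only [Matrix.cons_val, Nat.cast_ofNat, Nat.cast_zero, mul_zero, add_zero, zero_add] at e0211
  have e2110 := key ![2, 1, 1, 0] ![![0, 0, 0, 0, 0, 0], ![0, 0, 0, 0, 0, 0], ![0, 0, 0, 0, 0, 0], ![24, 12, 12, 12, 12, 8]] (by decide) (by decide)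
  simp only [Matrix.cons_val, Nat.cast_ofNat, Nat.cast_zero, mul_zero, add_zero, zero_add] at e2110
  have e1012 := key ![1, 0, 1, 2] ![![0, 0, 0, 0, 0, 0], ![12, 12, 24, 8, 12, 12], ![0, 0, 0, 0, 0, 0], ![0, 0, 0, 0, 0, 0]] (by decide) (by decide)
  simp only [Matrix.cons_val, Nat.cast_ofNat, Nat.cast_zero, mul_zero, add_zero, zero_add] at e1012
  have e1120 := key ![1, 1, 2, 0] ![![0, 0, 0, 0, 0, 0], ![0, 0, 0, 0, 0, 0], ![0, 0, 0, 0, 0, 0], ![12, 12, 24, 8, 12, 12]] (by decide) (by decide)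
  simp only [Matrix.cons_val, Nat.cast_ofNat, Nat.cast_zero, mul_zero, add_zero, zero_add] at e1120
  have e0310 := key ![0, 3, 1, 0] ![![120, 36, 12, 48, 24, 12], ![0, 0, 0, 0, 0, 0], ![0, 0, 0, 0, 0, 0], ![12, 120, 36, 24, 12, 48]] (by decide) (by decide)
  simp only [Matrix.cons_val, Nat.cast_ofNat, Nat.cast_zero, mul_zero, add_zero, zero_add] at e0310
  have e0103 := key ![0, 1, 0, 3] ![![36, 12, 120, 12, 48, 24], ![0, 0, 0, 0, 0, 0], ![12, 36, 120, 12, 24, 48], ![0, 0, 0, 0, 0, 0]] (by decide) (by decide)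
  simp only [Matrix.cons_val, Nat.cast_ofNat, Nat.cast_zero, mul_zero, add_zero, zero_add] at e0103
  have e0031 := key ![0, 0, 3, 1] ![![12, 120, 36, 24, 12, 48], ![12, 120, 36, 24, 12, 48], ![0, 0, 0, 0, 0, 0], ![0, 0, 0, 0, 0, 0]] (by decide) (by decide)
  simp only [Matrix.cons_val, Nat.cast_ofNat, Nat.cast_zero, mul_zero, add_zero, zero_add] at e0031
  have e0202 := key ![0, 2, 0, 2] ![![48, 8, 48, 12, 36, 12], ![0, 0, 0, 0, 0, 0], ![8, 48, 48, 12, 12, 36], ![0, 0, 0, 0, 0, 0]] (by decide) (by decide)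
  simp only [Matrix.cons_val, Nat.cast_ofNat, Nat.cast_zero, mul_zero, add_zero, zero_add] at e0202
  have e0022 := key ![0, 0, 2, 2] ![![8, 48, 48, 12, 12, 36], ![8, 48, 48, 12, 12, 36], ![0, 0, 0, 0, 0, 0], ![0, 0, 0, 0, 0, 0]] (by decide) (by decide)
  simp only [Matrix.cons_val, Nat.cast_ofNat, Nat.cast_zero, mul_zero, add_zero, zero_add] at e0022
  have e0301 := key ![0, 3, 0, 1] ![![120, 12, 36, 24, 48, 12], ![0, 0, 0, 0, 0, 0], ![12, 120, 36, 24, 12, 48], ![0, 0, 0, 0, 0, 0]] (by decide) (by decide)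
  simp only [Matrix.cons_val, Nat.cast_ofNat, Nat.cast_zero, mul_zero, add_zero, zero_add] at e0301
  have e3001 := key ![3, 0, 0, 1] ![![0, 0, 0, 0, 0, 0], ![120, 12, 36, 24, 48, 12], ![120, 12, 36, 24, 48, 12], ![0, 0, 0, 0, 0, 0]] (by decide) (by decide)
  simp only [Matrix.cons_val, Nat.cast_ofNat, Nat.cast_zero, mul_zero, add_zero, zero_add] at e3001
  have e1300 := key ![1, 3, 0, 0] ![![0, 0, 0, 0, 0, 0], ![0, 0, 0, 0, 0, 0], ![36, 120, 12, 48, 12, 24], ![36, 120, 12, 48, 12, 24]] (by decide) (by decide)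
  simp only [Matrix.cons_val, Nat.cast_ofNat, Nat.cast_zero, mul_zero, add_zero, zero_add] at e1300
  have e0013 := key ![0, 0, 1, 3] ![![12, 36, 120, 12, 24, 48], ![12, 36, 120, 12, 24, 48], ![0, 0, 0, 0, 0, 0], ![0, 0, 0, 0, 0, 0]] (by decide) (by decide)
  simp only [Matrix.cons_val, Nat.cast_ofNat, Nat.cast_zero, mul_zero, add_zero, zero_add] at e0013
  have e0130 := key ![0, 1, 3, 0] ![![36, 120, 12, 48, 12, 24], ![0, 0, 0, 0, 0, 0], ![0, 0, 0, 0, 0, 0], ![12, 36, 120, 12, 24, 48]] (by decide) (by decide)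
  simp only [Matrix.cons_val, Nat.cast_ofNat, Nat.cast_zero, mul_zero, add_zero, zero_add] at e0130
  have e3100 := key ![3, 1, 0, 0] ![![0, 0, 0, 0, 0, 0], ![0, 0, 0, 0, 0, 0], ![120, 36, 12, 48, 24, 12], ![120, 36, 12, 48, 24, 12]] (by decide) (by decide)
  simp only [Matrix.cons_val, Nat.cast_ofNat, Nat.cast_zero, mul_zero, add_zero, zero_add] at e3100
  have e1003 := key ![1, 0, 0, 3] ![![0, 0, 0, 0, 0, 0], ![36, 12, 120, 12, 48, 24], ![36, 12, 120, 12, 48, 24], ![0, 0, 0, 0, 0, 0]] (by decide) (by decide)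
  simp only [Matrix.cons_val, Nat.cast_ofNat, Nat.cast_zero, mul_zero, add_zero, zero_add] at e1003
  intro i s
  fin_cases i <;> fin_cases s
  · change c 0 0 = 0
    linear_combination (-25/224) * e1021 + (-25/224) * e1201 + (-3/112) * e2101 + (-1/112) * e0121 + (41/224) * e1102 + (3/224) * e0112 + (15/224) * e2011 + (5/224) * e0211 + (-3/32) * e2110 + (5/56) * e1012 + (3/32) * e1120 + (1/224) * e0103 + (5/224) * e0031 + (-5/112) * e0202 + (-5/112) * e0022 + (5/224) * e0301 + (-5/672) * e3001 + (5/336) * e0013 + (-1/96) * e0130 + (1/96) * e3100 + (-5/336) * e1003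
  · change c 0 1 = 0
    linear_combination (-11/224) * e1021 + (-11/224) * e1201 + (9/56) * e2101 + (-1/112) * e0121 + (-29/224) * e1102 + (-11/224) * e0112 + (15/224) * e2011 + (-9/224) * e0211 + (3/32) * e2110 + (-1/28) * e1012 + (-3/32) * e1120 + (1/224) * e0103 + (1/672) * e0031 + (1/56) * e0202 + (1/56) * e0022 + (1/672) * e0301 + (-5/672) * e3001 + (-1/168) * e0013 + (1/96) * e0130 + (-1/96) * e3100 + (1/168) * e1003
  · change c 0 2 = 0
    linear_combination (-1/56) * e1021 + (-1/56) * e1201 + (-3/112) * e2101 + (-1/112) * e0121 + (5/56) * e1102 + (5/112) * e0112 + (-3/112) * e2011 + (-1/112) * e0211 + (5/56) * e1012 + (5/336) * e0103 + (1/84) * e0031 + (-5/112) * e0202 + (-5/112) * e0022 + (1/84) * e0301 + (1/336) * e3001 + (5/336) * e0013 + (-5/336) * e1003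
  · change c 0 3 = 0
    linear_combination (3/14) * e1021 + (3/14) * e1201 + (-27/112) * e2101 + (3/28) * e0121 + (3/56) * e1102 + (-1/28) * e0112 + (-27/112) * e2011 + (3/28) * e0211 + (3/56) * e1012 + (1/112) * e0103 + (-1/56) * e0031 + (-3/112) * e0202 + (-3/112) * e0022 + (-1/56) * e0301 + (3/112) * e3001 + (1/112) * e0013 + (-1/112) * e1003
  · change c 0 4 = 0
    linear_combination (27/224) * e1021 + (27/224) * e1201 + (9/28) * e2101 + (-1/7) * e0121 + (-135/224) * e1102 + (-15/224) * e0112 + (9/224) * e2011 + (3/224) * e0211 + (9/32) * e2110 + (-9/28) * e1012 + (-9/32) * e1120 + (-5/224) * e0103 + (-11/224) * e0031 + (9/56) * e0202 + (9/56) * e0022 + (-11/224) * e0301 + (-1/224) * e3001 + (-3/56) * e0013 + (1/32) * e0130 + (-1/32) * e3100 + (3/56) * e1003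
  · change c 0 5 = 0
    linear_combination (-15/224) * e1021 + (-15/224) * e1201 + (-27/112) * e2101 + (3/28) * e0121 + (75/224) * e1102 + (27/224) * e0112 + (9/224) * e2011 + (-11/224) * e0211 + (-9/32) * e2110 + (3/56) * e1012 + (9/32) * e1120 + (-5/224) * e0103 + (3/224) * e0031 + (-3/112) * e0202 + (-3/112) * e0022 + (3/224) * e0301 + (-1/224) * e3001 + (1/112) * e0013 + (-1/32) * e0130 + (1/32) * e3100 + (-1/112) * e1003
  · change c 1 0 = 0
    linear_combination (1/224) * e1021 + (25/224) * e1201 + (3/112) * e2101 + (-11/112) * e0121 + (-41/224) * e1102 + (-27/224) * e0112 + (15/224) * e2011 + (25/224) * e0211 + (3/32) * e2110 + (-11/56) * e1012 + (-3/32) * e1120 + (-1/224) * e0103 + (-3/224) * e0031 + (5/112) * e0202 + (1/16) * e0022 + (-5/224) * e0301 + (5/672) * e3001 + (-1/168) * e0013 + (1/96) * e0130 + (-1/96) * e3100 + (5/336) * e1003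
  · change c 1 1 = 0
    linear_combination (1/224) * e1021 + (11/224) * e1201 + (-9/56) * e2101 + (-1/28) * e0121 + (29/224) * e1102 + (15/224) * e0112 + (-13/224) * e2011 + (11/224) * e0211 + (-3/32) * e2110 + (3/56) * e1012 + (3/32) * e1120 + (-1/224) * e0103 + (19/672) * e0031 + (-1/56) * e0202 + (-1/16) * e0022 + (-1/672) * e0301 + (5/672) * e3001 + (5/336) * e0013 + (-1/96) * e0130 + (1/96) * e3100 + (-1/168) * e1003
  · change c 1 2 = 0
    linear_combination (1/28) * e1021 + (1/56) * e1201 + (3/112) * e2101 + (3/112) * e0121 + (-5/56) * e1102 + (-5/56) * e0112 + (1/28) * e2011 + (1/56) * e0211 + (-15/112) * e1012 + (-5/336) * e0103 + (-1/336) * e0031 + (5/112) * e0202 + (-1/84) * e0301 + (-1/336) * e3001 + (5/336) * e0013 + (5/336) * e1003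
  · change c 1 3 = 0
    linear_combination (15/112) * e1021 + (-3/14) * e1201 + (27/112) * e2101 + (27/112) * e0121 + (-3/56) * e1102 + (-3/56) * e0112 + (15/112) * e2011 + (-3/14) * e0211 + (-1/7) * e1012 + (-1/112) * e0103 + (-3/112) * e0031 + (3/112) * e0202 + (1/56) * e0301 + (-3/112) * e3001 + (1/112) * e0013 + (1/112) * e1003
  · change c 1 4 = 0
    linear_combination (-47/224) * e1021 + (-27/224) * e1201 + (-9/28) * e2101 + (3/56) * e0121 + (135/224) * e1102 + (93/224) * e0112 + (-33/224) * e2011 + (-27/224) * e0211 + (-9/32) * e2110 + (75/112) * e1012 + (9/32) * e1120 + (5/224) * e0103 + (15/224) * e0031 + (-9/56) * e0202 + (-3/16) * e0022 + (11/224) * e0301 + (1/224) * e3001 + (1/112) * e0013 + (-1/32) * e0130 + (1/32) * e3100 + (-3/56) * e1003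
  · change c 1 5 = 0
    linear_combination (9/224) * e1021 + (15/224) * e1201 + (27/112) * e2101 + (-15/112) * e0121 + (-75/224) * e1102 + (-33/224) * e0112 + (-5/224) * e2011 + (15/224) * e0211 + (9/32) * e2110 + (-9/112) * e1012 + (-9/32) * e1120 + (5/224) * e0103 + (-13/224) * e0031 + (3/112) * e0202 + (3/16) * e0022 + (-3/224) * e0301 + (1/224) * e3001 + (-3/56) * e0013 + (1/32) * e0130 + (-1/32) * e3100 + (1/112) * e1003
  · change c 2 0 = 0
    linear_combination (11/224) * e1021 + (-13/224) * e1201 + (-3/112) * e2101 + (1/7) * e0121 + (5/224) * e1102 + (-13/224) * e0112 + (-15/224) * e2011 + (-15/224) * e0211 + (-3/32) * e2110 + (1/28) * e1012 + (3/32) * e1120 + (1/224) * e0103 + (-1/672) * e0031 + (-1/56) * e0022 + (5/672) * e0301 + (5/672) * e3001 + (1/168) * e0013 + (-1/96) * e0130 + (1/96) * e3100 + (-1/168) * e1003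
  · change c 2 1 = 0
    linear_combination (25/224) * e1021 + (15/224) * e1201 + (1/28) * e2101 + (1/56) * e0121 + (-37/224) * e1102 + (1/224) * e0112 + (-15/224) * e2011 + (-15/224) * e0211 + (3/32) * e2110 + (-5/56) * e1012 + (-3/32) * e1120 + (1/224) * e0103 + (-5/224) * e0031 + (5/112) * e0022 + (5/672) * e0301 + (5/672) * e3001 + (-5/336) * e0013 + (1/96) * e0130 + (-1/96) * e3100 + (5/336) * e1003
  · change c 2 2 = 0
    linear_combination (1/56) * e1021 + (1/28) * e1201 + (1/28) * e2101 + (1/56) * e0121 + (-15/112) * e1102 + (-5/56) * e0112 + (3/112) * e2011 + (3/112) * e0211 + (-5/56) * e1012 + (5/336) * e0103 + (-1/84) * e0031 + (5/112) * e0022 + (-1/336) * e0301 + (-1/336) * e3001 + (-5/336) * e0013 + (5/336) * e1003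
  · change c 2 3 = 0
    linear_combination (-3/14) * e1021 + (15/112) * e1201 + (15/112) * e2101 + (-3/14) * e0121 + (-1/7) * e1102 + (-3/56) * e0112 + (27/112) * e2011 + (27/112) * e0211 + (-3/56) * e1012 + (1/112) * e0103 + (1/56) * e0031 + (3/112) * e0022 + (-3/112) * e0301 + (-3/112) * e3001 + (-1/112) * e0013 + (1/112) * e1003
  · change c 2 4 = 0
    linear_combination (15/224) * e1021 + (-5/224) * e1201 + (15/112) * e2101 + (-3/14) * e0121 + (3/224) * e1102 + (51/224) * e0112 + (-9/224) * e2011 + (-9/224) * e0211 + (9/32) * e2110 + (-3/56) * e1012 + (-9/32) * e1120 + (-5/224) * e0103 + (-3/224) * e0031 + (3/112) * e0022 + (1/224) * e0301 + (1/224) * e3001 + (-1/112) * e0013 + (1/32) * e0130 + (-1/32) * e3100 + (1/112) * e1003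
  · change c 2 5 = 0
    linear_combination (-27/224) * e1021 + (-33/224) * e1201 + (-17/56) * e2101 + (9/56) * e0121 + (129/224) * e1102 + (9/224) * e0112 + (-9/224) * e2011 + (-9/224) * e0211 + (-9/32) * e2110 + (9/28) * e1012 + (9/32) * e1120 + (-5/224) * e0103 + (11/224) * e0031 + (-9/56) * e0022 + (1/224) * e0301 + (1/224) * e3001 + (3/56) * e0013 + (-1/32) * e0130 + (1/32) * e3100 + (-3/56) * e1003
  · change c 3 0 = 0
    linear_combination (1/16) * e1021 + (-1/14) * e1210 + (11/112) * e1201 + (3/112) * e2101 + (-11/112) * e0121 + (-19/112) * e1102 + (9/112) * e0112 + (-5/56) * e0211 + (9/56) * e2110 + (-1/8) * e1012 + (-17/112) * e1120 + (5/336) * e0310 + (-1/84) * e0103 + (-1/48) * e0031 + (5/112) * e0202 + (1/16) * e0022 + (-5/336) * e0301 + (-1/168) * e1300 + (-1/48) * e0013 + (1/56) * e0130 + (-1/336) * e3100 + (1/48) * e1003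
  · change c 3 1 = 0
    linear_combination (-15/112) * e1210 + (-5/56) * e1201 + (3/112) * e2101 + (3/112) * e0121 + (1/56) * e1102 + (1/56) * e0112 + (-5/56) * e0211 + (1/28) * e2110 + (1/28) * e1120 + (5/336) * e0310 + (-1/84) * e0103 + (5/112) * e0202 + (-5/336) * e0301 + (5/336) * e1300 + (-1/336) * e0130 + (-1/336) * e3100
  · change c 3 2 = 0
    linear_combination (-1/16) * e1021 + (-1/14) * e1210 + (-17/112) * e1201 + (-9/56) * e2101 + (-1/28) * e0121 + (37/112) * e1102 + (9/112) * e0112 + (1/28) * e0211 + (-17/112) * e2110 + (1/8) * e1012 + (9/56) * e1120 + (-1/168) * e0310 + (-1/84) * e0103 + (1/48) * e0031 + (-1/56) * e0202 + (-1/16) * e0022 + (1/168) * e0301 + (5/336) * e1300 + (1/48) * e0013 + (-1/336) * e0130 + (1/56) * e3100 + (-1/48) * e1003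
  · change c 3 3 = 0
    linear_combination (-3/16) * e1021 + (33/112) * e1210 + (-27/112) * e1201 + (-9/28) * e2101 + (3/56) * e0121 + (81/112) * e1102 + (-3/112) * e0112 + (9/28) * e0211 + (-3/7) * e2110 + (3/8) * e1012 + (29/112) * e1120 + (-3/56) * e0310 + (1/56) * e0103 + (1/16) * e0031 + (-9/56) * e0202 + (-3/16) * e0022 + (3/56) * e0301 + (1/112) * e1300 + (1/16) * e0013 + (-3/112) * e0130 + (1/28) * e3100 + (-1/16) * e1003
  · change c 3 4 = 0
    linear_combination (-1/7) * e1210 + (-3/56) * e1201 + (27/112) * e2101 + (27/112) * e0121 + (-3/14) * e1102 + (-3/14) * e0112 + (-3/56) * e0211 + (15/112) * e2110 + (15/112) * e1120 + (1/112) * e0310 + (1/56) * e0103 + (3/112) * e0202 + (-1/112) * e0301 + (1/112) * e1300 + (-3/112) * e0130 + (-3/112) * e3100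
  · change c 3 5 = 0
    linear_combination (3/16) * e1021 + (33/112) * e1210 + (57/112) * e1201 + (27/112) * e2101 + (-15/112) * e0121 + (-87/112) * e1102 + (-3/112) * e0112 + (-3/56) * e0211 + (29/112) * e2110 + (-3/8) * e1012 + (-3/7) * e1120 + (1/112) * e0310 + (1/56) * e0103 + (-1/16) * e0031 + (3/112) * e0202 + (3/16) * e0022 + (-1/112) * e0301 + (-3/56) * e1300 + (-1/16) * e0013 + (1/28) * e0130 + (-3/112) * e3100 + (1/16) * e1003

lemma finrank_W : Module.finrank ℝ (restrictTotalDegree (Fin 3) ℝ 4) = 35 := by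
  rw [restrictTotalDegree, Module.finrank_eq_nat_card_basis (basisRestrictSupport ℝ _)]
  have hsum : ∀ n : Fin 3 →₀ ℕ, (n.sum fun _ e => e) = n 0 + n 1 + n 2 := by
    intro n
    rw [Finsupp.sum_fintype _ _ (by simp), Fin.sum_univ_three]
  let e : {n : Fin 3 →₀ ℕ | (n.sum fun _ e => e) ≤ 4} ≃
      {f : Fin 3 → Fin 5 // (f 0 : ℕ) + f 1 + f 2 ≤ 4} :=
    { toFun := fun n => ⟨fun j => ⟨n.1 j, by
        have := n.2
        simp only [Set.mem_ofPred_eq, hsum] at this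
        fin_cases j <;> simp <;> omega⟩, by
        have := n.2
        simp only [Set.mem_ofPred_eq, hsum] at this
        simpa using this⟩
      invFun := fun f => ⟨Finsupp.equivFunOnFinite.symm fun j => (f.1 j : ℕ), by
        simp only [Set.mem_ofPred_eq, hsum]
        simpa using f.2⟩
      left_inv := by
        intro n
        ext j
        simp
      right_inv := by
        intro f
        ext j
        simp }
  rw [Nat.card_congr e, Nat.card_eq_fintype_card]
  decide +kernel

lemma monomial_mem (L : Submodule ℝ (MvPolynomial (Fin 3) ℝ)) (h1 : 1 ∈ L) (hX : ∀ j, X j ∈ L) :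
    ∀ (n : ℕ) (m : Fin 3 →₀ ℕ), m.degree ≤ n → monomial m (1 : ℝ) ∈ L ^ n := by
  intro n
  induction n with
  | zero =>
    intro m hm
    have : m = 0 := (Finsupp.degree_eq_zero_iff m).1 (Nat.le_zero.1 hm)
    subst this
    simp only [pow_zero]
    exact Submodule.one_le.1 le_rfl
  | succ n ih =>
    intro m hm
    by_cases h0 : m = 0
    · subst h0
      have : (monomial (0 : Fin 3 →₀ ℕ) (1:ℝ)) = 1 ^ (n + 1) := by simp
      rw [this]
      exact Submodule.pow_mem_pow _ h1 _
    · obtain ⟨j, hj⟩ := Finsupp.ne_iff.1 h0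
      have hle : Finsupp.single j 1 ≤ m := by
        rw [Finsupp.single_le_iff]
        exact Nat.one_le_iff_ne_zero.2 hj
      have hm' : m = (m - Finsupp.single j 1) + Finsupp.single j 1 := (tsub_add_cancel_of_le hle).symm
      have hd := congrArg Finsupp.degree hm'
      rw [map_add, Finsupp.degree_single] at hd
      have : monomial m (1:ℝ) = monomial (m - Finsupp.single j 1) 1 * X j := by
        rw [X, monomial_mul, ← hm', one_mul]
      rw [this, pow_succ]
      exact Submodule.mul_mem_mul (ih _ (by omega)) (hX j)

lemma deg_two_mem (lam : Fin 4 → MvPolynomial (Fin 3) ℝ)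
    (h1 : 1 ∈ Submodule.span ℝ (Set.range lam)) (hX : ∀ j, X j ∈ Submodule.span ℝ (Set.range lam))
    (q : MvPolynomial (Fin 3) ℝ) (hq : q.totalDegree ≤ 2) :
    q ∈ Submodule.span ℝ (Set.range fun jk : Fin 4 × Fin 4 => lam jk.1 * lam jk.2) := by
  have h2 : q ∈ Submodule.span ℝ (Set.range lam) ^ 2 := by
    rw [← mem_restrictTotalDegree, restrictTotalDegree, restrictSupport_eq_span] at hq
    refine Submodule.span_le.2 ?_ hq
    rintro _ ⟨m, hm, rfl⟩
    exact monomial_mem _ h1 hX 2 m hm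
  rw [pow_two, Submodule.span_mul_span] at h2
  refine Submodule.span_mono ?_ h2
  rintro _ ⟨_, ⟨j, rfl⟩, _, ⟨k, rfl⟩, rfl⟩
  exact ⟨(j, k), rfl⟩

lemma ex_self (i : Fin 4) (s : Fin 6) : ex i s i = 0 := by
  simp [ex, Fin.ne_succAbove]

lemma ex_sum (i : Fin 4) (s : Fin 6) : ∑ j, ex i s j = 2 := by
  simp [ex, Finset.sum_add_distrib]

lemma prod_ex (lam : Fin 4 → MvPolynomial (Fin 3) ℝ) (i : Fin 4) (s : Fin 6) :
    ∏ j, lam j ^ ex i s j = lam (i.succAbove (k1 s)) * lam (i.succAbove (k2 s)) := by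
  simp only [ex, pow_add, Finset.prod_mul_distrib, pow_ite, pow_one, pow_zero, Finset.prod_ite_eq',
    Finset.mem_univ, if_true]

lemma pair_cases (k l : Fin 3) : ∃ s : Fin 6, (k = k1 s ∧ l = k2 s) ∨ (k = k2 s ∧ l = k1 s) := by
  revert k l
  decide

lemma J_zero (a : Fin 4 → E3) (lam : Fin 4 → MvPolynomial (Fin 3) ℝ)
    (h1 : ∀ i u v w z, evalP (par u v w z) (lam i) =
        z.1 * evalP u (lam i) + z.2 * evalP v (lam i) + (1 - z.1 - z.2) * evalP w (lam i))
    (h2 : ∀ i j, evalP (a j) (lam i) = if i = j then 1 else 0) (i : Fin 4)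
    (p : MvPolynomial (Fin 3) ℝ) : J a i (p * lam i) = 0 := by
  have : ∀ z, evalP (fpar a i z) (p * lam i) = 0 := by
    intro z
    have hz : evalP (fpar a i z) (lam i) = 0 := by
      simp [fpar, h1, h2, Fin.ne_succAbove]
    have : evalP (fpar a i z) (p * lam i) = evalP (fpar a i z) p * evalP (fpar a i z) (lam i) := by
      simp [evalP]
    rw [this, hz, mul_zero]
  change ∫ z in Tri, evalP (fpar a i z) (p * lam i) = 0
  simp [this]

lemma totalDegree_prod_lam (lam : Fin 4 → MvPolynomial (Fin 3) ℝ)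
    (hdeg : ∀ i, (lam i).totalDegree ≤ 1) (α : Fin 4 → ℕ) :
    (∏ j, lam j ^ α j).totalDegree ≤ ∑ j, α j := by
  refine (totalDegree_finsetProd _ _).trans (Finset.sum_le_sum fun j _ => ?_)
  refine (totalDegree_pow _ _).trans ?_
  calc α j * (lam j).totalDegree ≤ α j * 1 := Nat.mul_le_mul_left _ (hdeg j)
    _ = α j := mul_one _

/-- The moment map. -/
def Phi (a : Fin 4 → E3) (lam : Fin 4 → MvPolynomial (Fin 3) ℝ) :
    restrictTotalDegree (Fin 3) ℝ 4 →ₗ[ℝ] (Fin 4 × Fin 6 → ℝ) :=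
  LinearMap.pi fun is =>
    (J a is.1 ∘ₗ LinearMap.mulRight ℝ (∏ j, lam j ^ ex is.1 is.2 j)) ∘ₗ Submodule.subtype _

lemma Phi_apply (a : Fin 4 → E3) (lam : Fin 4 → MvPolynomial (Fin 3) ℝ) (p) (is : Fin 4 × Fin 6) :
    Phi a lam p is = J a is.1 (p.1 * ∏ j, lam j ^ ex is.1 is.2 j) := rfl

lemma Phi_surj (a : Fin 4 → E3) (lam : Fin 4 → MvPolynomial (Fin 3) ℝ)
    (hdeg : ∀ i, (lam i).totalDegree ≤ 1)
    (h1 : ∀ i u v w z, evalP (par u v w z) (lam i) =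
        z.1 * evalP u (lam i) + z.2 * evalP v (lam i) + (1 - z.1 - z.2) * evalP w (lam i))
    (h2 : ∀ i j, evalP (a j) (lam i) = if i = j then 1 else 0) :
    LinearMap.range (Phi a lam) = ⊤ := by
  by_contra hne
  obtain ⟨f, hf0, hf⟩ := Submodule.exists_le_ker_of_lt_top _ (lt_top_iff_ne_top.2 hne)
  have hfe : ∀ v, f v = ∑ i, ∑ s, f (Pi.single (i, s) 1) * v (i, s) := by
    intro v
    conv_lhs => rw [LinearMap.pi_apply_eq_sum_univ f v]
    rw [Fintype.sum_prod_type]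
    refine Finset.sum_congr rfl fun i _ => Finset.sum_congr rfl fun s _ => ?_
    rw [smul_eq_mul, mul_comm]
    congr 2
    ext x
    simp [Pi.single_apply, eq_comm]
  have hc := comb (fun i s => f (Pi.single (i, s) 1)) (by
    intro α hα
    let p : restrictTotalDegree (Fin 3) ℝ 4 := ⟨∏ j, lam j ^ α j, by
      rw [mem_restrictTotalDegree]
      exact (totalDegree_prod_lam lam hdeg α).trans hα.le⟩
    have h0 : f (Phi a lam p) = 0 := hf ⟨p, rfl⟩
    rw [hfe] at h0
    have hK : ∀ i s, Phi a lam p (i, s) = (KK α i s : ℝ) / (8 : ℕ).factorial := by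
      intro i s
      rw [Phi_apply]
      simp only [p]
      rw [← Finset.prod_mul_distrib]
      simp_rw [← pow_add]
      rw [J_lam a lam h1 h2 i (fun j => α j + ex i s j)]
      simp only [Finset.sum_add_distrib, hα, ex_sum, ex_self, add_zero, KK]
      split_ifs <;> simp
    simp_rw [hK, mul_div_assoc', ← Finset.sum_div] at h0
    rcases div_eq_zero_iff.1 h0 with h | h
    · exact h
    · exact absurd h (by positivity))
  apply hf0
  refine LinearMap.ext fun v => ?_
  rw [hfe]
  exact Finset.sum_eq_zero fun i _ => Finset.sum_eq_zero fun s _ => by rw [hc i s, zero_mul]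


/-- the quartic bubble space `𝔅₄(T)` has dimension `11`. -/
theorem stmt4 (a : Fin 4 → E3) (hind : AffineIndependent ℝ a) :
    Set.finrank ℝ {p : MvPolynomial (Fin 3) ℝ | p.totalDegree ≤ 4 ∧
      ∀ (i : Fin 4) (q : MvPolynomial (Fin 3) ℝ), q.totalDegree ≤ 2 →
        ∫ x in face a i, evalP x p * evalP x q ∂(μH[2]) = 0} = 11 := by
  obtain ⟨lam, hdeg, hone, hX, h1, h2⟩ := exists_lam a hind
  have hS : {p : MvPolynomial (Fin 3) ℝ | p.totalDegree ≤ 4 ∧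
      ∀ (i : Fin 4) (q : MvPolynomial (Fin 3) ℝ), q.totalDegree ≤ 2 →
        ∫ x in face a i, evalP x p * evalP x q ∂(μH[2]) = 0} =
      ((LinearMap.ker (Phi a lam)).map (Submodule.subtype _) : Submodule ℝ _) := by
    ext p
    constructor
    · rintro ⟨hp, h⟩
      refine ⟨⟨p, (mem_restrictTotalDegree _ _ _).2 hp⟩, ?_, rfl⟩
      rw [SetLike.mem_coe, LinearMap.mem_ker]
      ext ⟨i, s⟩
      rw [Phi_apply]
      obtain ⟨c, hc, hci⟩ := face_integral a lam h1 h2 i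
      have := h i (∏ j, lam j ^ ex i s j)
        ((totalDegree_prod_lam lam hdeg _).trans (ex_sum i s).le)
      rw [hci] at this
      exact (mul_eq_zero.1 this).resolve_left hc
    · rintro ⟨⟨p, hp⟩, hk, rfl⟩
      refine ⟨(mem_restrictTotalDegree _ _ _).1 hp, fun i q hq => ?_⟩
      obtain ⟨c, hc, hci⟩ := face_integral a lam h1 h2 i
      rw [hci]
      have hk' : ∀ s, J a i (p * (lam (i.succAbove (k1 s)) * lam (i.succAbove (k2 s)))) = 0 := by
        intro s
        have := congrFun (LinearMap.mem_ker.1 hk) (i, s)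
        rwa [Phi_apply, prod_ex] at this
      have hle : Submodule.span ℝ (Set.range fun jk : Fin 4 × Fin 4 => lam jk.1 * lam jk.2) ≤
          LinearMap.ker (J a i ∘ₗ LinearMap.mulLeft ℝ p) := by
        rw [Submodule.span_le]
        rintro _ ⟨⟨j, k⟩, rfl⟩
        change J a i (p * (lam j * lam k)) = 0
        by_cases hj : j = i
        · subst hj
          rw [mul_comm (lam j), ← mul_assoc]
          exact J_zero a lam h1 h2 j _
        by_cases hk : k = i
        · subst hk
          rw [← mul_assoc]
          exact J_zero a lam h1 h2 k _
        obtain ⟨j, rfl⟩ := Fin.exists_succAbove_eq hj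
        obtain ⟨k, rfl⟩ := Fin.exists_succAbove_eq hk
        obtain ⟨s, ⟨rfl, rfl⟩ | ⟨rfl, rfl⟩⟩ := pair_cases j k
        · exact hk' s
        · rw [mul_comm (lam _)]
          exact hk' s
      have := hle (deg_two_mem lam hone hX q hq)
      have h0 : J a i (p * q) = 0 := this
      simp only [Submodule.subtype_apply]
      rw [h0, mul_zero]
  rw [hS, Set.finrank, Submodule.span_eq, Submodule.finrank_map_subtype_eq]
  have hr := LinearMap.finrank_range_add_finrank_ker (Phi a lam)
  rw [Phi_surj a lam hdeg h1 h2, finrank_top, finrank_W] at hr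
  simp at hr
  omega
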